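/- Let s(j) = (3^j − 5·(−1)^j)/4 for j ≥ 1 (the Sălăjan sequence 2, 1, 8, 19, 62, 181, …), and let D_5(n) denote the smallest positive integer m such that s(1), …, s(n) are pairwise incongruent modulo m. For every integer n ≥ 1, if e is the smallest nonnegative integer with 2^e ≥ n and f is the smallest nonnegative integer with 4·5^f ≥ 5n, then D_5(n) = min{2^e, 5^f}. -/

import Mathlib

/-- The Sălăjan sequence `s j = (3^j − 5·(−1)^j)/4` for `j ≥ 1`:
`2, 1, 8, 19, 62, 181, …`. -/
def salajan (j : ℕ) : ℤ := (3 ^ j - 5 * (-1) ^ j) / 4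

/-- The discriminator `D_5(n)`: the smallest positive integer `m` such that
`s 1, …, s n` are pairwise incongruent modulo `m`. -/
noncomputable def salajanDisc (n : ℕ) : ℕ :=
  sInf {m : ℕ | 0 < m ∧
    ∀ i, 1 ≤ i → i ≤ n → ∀ j, 1 ≤ j → j ≤ n →
      salajan i ≡ salajan j [ZMOD (m : ℤ)] → i = j}

/-- The shifted sequence `4 * salajan j + 5`, which takes values in the natural numbers. -/
def salajanShift (j : ℕ) : ℕ := 3 ^ j + 10 * (j % 2)

/-- The terms `salajan 1, …, salajan n` are pairwise incongruent modulo `m`. -/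
def Separates (m n : ℕ) : Prop :=
  ∀ i, 1 ≤ i → i ≤ n → ∀ j, 1 ≤ j → j ≤ n →
    salajanShift i ≡ salajanShift j [MOD 4 * m] → i = j

lemma four_dvd_three_pow_sub (j : ℕ) : (4 : ℤ) ∣ 3 ^ j - 5 * (-1) ^ j := by
  have h : (3 : ℤ) ^ j ≡ (-1) ^ j [ZMOD 4] := Int.ModEq.pow j (by decide)
  have h2 := (Int.modEq_iff_dvd.1 h)
  have : (3 : ℤ) ^ j - 5 * (-1) ^ j = -((-1) ^ j - 3 ^ j) - 4 * (-1) ^ j := by ring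
  rw [this]
  exact dvd_sub (h2.neg_right) (dvd_mul_right _ _)

lemma salajanShift_eq (j : ℕ) : (salajanShift j : ℤ) = 4 * salajan j + 5 := by
  have h : 4 * salajan j = 3 ^ j - 5 * (-1) ^ j := by
    rw [salajan, Int.mul_ediv_cancel' (four_dvd_three_pow_sub j)]
  rw [h, salajanShift]
  rcases Nat.even_or_odd j with hj | hj
  · simp [hj.neg_one_pow, Nat.even_iff.1 hj]
  · simp [hj.neg_one_pow, Nat.odd_iff.1 hj]; ring

lemma salajan_modEq_iff (m i j : ℕ) :
    salajan i ≡ salajan j [ZMOD (m : ℤ)] ↔ salajanShift i ≡ salajanShift j [MOD 4 * m] := by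
  rw [← Int.natCast_modEq_iff, Int.modEq_iff_dvd, Int.modEq_iff_dvd, salajanShift_eq,
    salajanShift_eq, show 4 * salajan j + 5 - (4 * salajan i + 5) = 4 * (salajan j - salajan i) by
      ring, Nat.cast_mul]
  exact (mul_dvd_mul_iff_left (by norm_num : (4 : ℤ) ≠ 0)).symm

lemma salajanShift_modEq_four (i j : ℕ) : salajanShift i ≡ salajanShift j [MOD 4] := by
  have := (salajan_modEq_iff 1 i j).1 (by simp [Int.modEq_one])
  simpa using this

/-- For odd `m` the factor `4` in the modulus may be dropped. -/
lemma Separates.eq_of_modEq {m n : ℕ} (h : Separates m n) (hm : Odd m) {i j : ℕ} (hi : 1 ≤ i)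
    (hin : i ≤ n) (hj : 1 ≤ j) (hjn : j ≤ n)
    (hij : salajanShift i ≡ salajanShift j [MOD m]) : i = j := by
  refine h i hi hin j hj hjn ?_
  have hc : Nat.Coprime 4 m := by
    have : Nat.Coprime (2 ^ 2) m := (Nat.coprime_two_left.2 hm).pow_left 2
    simpa using this
  exact (Nat.modEq_and_modEq_iff_modEq_mul hc).1 ⟨salajanShift_modEq_four i j, hij⟩

/-- A separated even-indexed and odd-indexed pair never differs by `10`. -/
lemma Separates.three_pow_sub_ne {m n : ℕ} (h : Separates m n) (hm : Odd m) {i j : ℕ}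
    (hi : 1 ≤ i) (hin : i ≤ n) (hi2 : Even i) (hjn : j ≤ n) (hj2 : Odd j) :
    (3 : ZMod m) ^ i - 3 ^ j ≠ 10 := by
  intro heq
  have := h.eq_of_modEq hm hi hin hj2.pos hjn (by
    rw [← ZMod.natCast_eq_natCast_iff]
    simp only [salajanShift, Nat.even_iff.1 hi2, Nat.odd_iff.1 hj2]
    push_cast
    linear_combination heq)
  subst this
  exact (Nat.not_even_iff_odd.2 hj2) hi2

lemma Separates.lt_period {m n c k M : ℕ} (h : Separates m n) (hm : m ∣ 3 ^ c * M)
    (hc : 1 ≤ c) (hk : 0 < k) (h9 : 9 ^ k ≡ 1 [MOD 4 * M]) : n < c + 2 * k := by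
  by_contra! hn
  have := h c hc (by omega) (c + 2 * k) (by omega) hn (by
    have h1 : salajanShift (c + 2 * k) = 3 ^ c * 9 ^ k + 10 * (c % 2) := by
      rw [salajanShift, pow_add, pow_mul]; norm_num
    rw [h1, salajanShift]
    refine Nat.ModEq.add_right _ (Nat.ModEq.symm ?_)
    have h2 : 3 ^ c * 9 ^ k ≡ 3 ^ c * 1 [MOD 3 ^ c * (4 * M)] := Nat.ModEq.mul_left' _ h9
    rw [mul_one] at h2
    exact h2.of_dvd (by
      rw [show 3 ^ c * (4 * M) = 4 * (3 ^ c * M) by ring]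
      exact Nat.mul_dvd_mul_left 4 hm))
  omega

lemma nine_pow_modEq_of_two_pow (a : ℕ) : 9 ^ 2 ^ a ≡ 1 [MOD 2 ^ (a + 3)] := by
  induction a with
  | zero => decide
  | succ a ih =>
    rw [Nat.ModEq.comm, Nat.modEq_iff_dvd] at ih ⊢
    push_cast at ih ⊢
    rw [show (9 : ℤ) ^ 2 ^ (a + 1) - 1 = (9 ^ 2 ^ a - 1) * (9 ^ 2 ^ a + 1) by ring,
      show (2 : ℤ) ^ (a + 1 + 3) = 2 ^ (a + 3) * 2 by ring]
    exact mul_dvd_mul ih (by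
      have : Odd ((9 : ℤ) ^ 2 ^ a) := Odd.pow (by decide)
      exact (this.add_odd odd_one).two_dvd)

lemma nine_pow_half_totient_modEq {w : ℕ} (hw : 2 < w) (h3 : Nat.Coprime 3 w) :
    9 ^ (w.totient / 2) ≡ 1 [MOD w] := by
  have h2 := (Nat.totient_even hw).two_dvd
  rw [show 9 = 3 ^ 2 by norm_num, ← pow_mul, Nat.mul_div_cancel' h2]
  exact Nat.ModEq.pow_totient h3

lemma nine_pow_modEq_four_mul {w k : ℕ} (hw : Odd w) (h : 9 ^ k ≡ 1 [MOD w]) :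
    9 ^ k ≡ 1 [MOD 4 * w] := by
  have hc : Nat.Coprime 4 w := by
    have : Nat.Coprime (2 ^ 2) w := (Nat.coprime_two_left.2 hw).pow_left 2
    simpa using this
  refine (Nat.modEq_and_modEq_iff_modEq_mul hc).1 ⟨?_, h⟩
  have : 9 ^ k ≡ 1 ^ k [MOD 4] := Nat.ModEq.pow k (by decide)
  simpa using this

lemma nine_pow_modEq_two_pow_mul {w a k : ℕ} (hw : Odd w) (h : 9 ^ k ≡ 1 [MOD w]) :
    9 ^ (2 ^ a * k) ≡ 1 [MOD 4 * (2 ^ (a + 1) * w)] := by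
  have hc : Nat.Coprime (2 ^ (a + 3)) w := (Nat.coprime_two_left.2 hw).pow_left _
  rw [show 4 * (2 ^ (a + 1) * w) = 2 ^ (a + 3) * w by ring]
  refine (Nat.modEq_and_modEq_iff_modEq_mul hc).1 ⟨?_, ?_⟩
  · rw [pow_mul]
    simpa using (nine_pow_modEq_of_two_pow a).pow k
  · rw [mul_comm, pow_mul]
    simpa using h.pow (2 ^ a)

/-- `9` has a period of length at most `M / 2` modulo `4 * M`, for `M` prime to `3`. -/
lemma exists_nine_pow_modEq {M : ℕ} (hM : 0 < M) (h3 : ¬ 3 ∣ M) :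
    ∃ k, 0 < k ∧ 2 * k ≤ max M 2 ∧ 9 ^ k ≡ 1 [MOD 4 * M] := by
  obtain ⟨a, w, hw2, rfl⟩ := Nat.exists_eq_two_pow_mul_odd hM.ne'
  have hw3 : Nat.Coprime 3 w :=
    (Nat.Prime.coprime_iff_not_dvd Nat.prime_three).2 fun h => h3 (h.mul_left _)
  rcases eq_or_ne w 1 with rfl | hw1
  · rcases a with _ | a
    · exact ⟨1, by norm_num, by simp, by decide⟩
    · refine ⟨2 ^ a * 1, by positivity, ?_, nine_pow_modEq_two_pow_mul hw2 (Nat.modEq_one)⟩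
      rw [pow_succ]; omega
  · have hw : 2 < w := by
      rcases hw2 with ⟨t, rfl⟩; omega
    have h2 := (Nat.totient_even hw).two_dvd
    have hlt := Nat.totient_lt w (by omega)
    have hpos := Nat.totient_pos.2 (by omega : 0 < w)
    have h9 := nine_pow_half_totient_modEq hw hw3
    rcases a with _ | a
    · exact ⟨w.totient / 2, by omega, by simp; omega, by
        simpa using nine_pow_modEq_four_mul hw2 h9⟩
    · refine ⟨2 ^ a * (w.totient / 2), ?_, ?_, nine_pow_modEq_two_pow_mul hw2 h9⟩
      · have : 0 < w.totient / 2 := by omega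
        positivity
      · refine le_max_of_le_left ?_
        calc 2 * (2 ^ a * (w.totient / 2)) = 2 ^ (a + 1) * (w.totient / 2) := by ring
          _ ≤ 2 ^ (a + 1) * w := by gcongr; omega

/-- A separating modulus that is small compared with `n` is prime to `3`. -/
lemma Separates.not_three_dvd {m n : ℕ} (h : Separates m n) (hm : 0 < m) (hmn : m + 3 ≤ 2 * n) :
    ¬ 3 ∣ m := by
  intro h3
  obtain ⟨c, M, hM3, rfl⟩ := Nat.exists_eq_pow_mul_and_not_dvd hm.ne' 3 (by norm_num)
  have hM : 0 < M := Nat.pos_of_ne_zero (by rintro rfl; simp at hm)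
  have hc : 1 ≤ c := by
    rcases c with _ | c
    · simp at h3; contradiction
    · omega
  obtain ⟨k, hk, hkM, h9⟩ := exists_nine_pow_modEq hM hM3
  have hlt := h.lt_period dvd_rfl hc hk h9
  have hmax : max M 2 ≤ M + 1 := by omega
  have h3c : c = 1 ∨ 2 * c + 2 ≤ 3 ^ c ∧ 2 ≤ c := by
    rcases Nat.lt_or_ge c 2 with h1 | h2
    · left; omega
    · right
      refine ⟨?_, h2⟩
      induction c, h2 using Nat.le_induction with
      | base => norm_num
      | succ c hc2 ih =>
        clear * - hc2
        induction c, hc2 using Nat.le_induction with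
        | base => norm_num
        | succ c hc ih => rw [pow_succ]; omega
  rcases h3c with rfl | ⟨h3c, h2c⟩
  · rcases Nat.lt_or_ge M 2 with h1 | h1
    · have : M = 1 := by omega
      subst this
      simp at hkM hmn
      omega
    · rw [max_eq_left h1] at hkM
      omega
  · have : (2 * c + 2) * M ≤ 3 ^ c * M := Nat.mul_le_mul_right _ h3c
    nlinarith

/-- An even separating modulus that is small compared with `n` is a power of two. -/
lemma Separates.eq_two_pow_of_even {m n : ℕ} (h : Separates m n) (hm : 0 < m)
    (hmn : m + 3 ≤ 2 * n) (h2 : Even m) : ∃ a, m = 2 ^ a := by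
  have h3 := h.not_three_dvd hm hmn
  obtain ⟨a, w, hw2, rfl⟩ := Nat.exists_eq_two_pow_mul_odd hm.ne'
  have hw3 : Nat.Coprime 3 w :=
    (Nat.Prime.coprime_iff_not_dvd Nat.prime_three).2 fun h => h3 (h.mul_left _)
  rcases eq_or_ne w 1 with rfl | hw1
  · exact ⟨a, by simp⟩
  exfalso
  have hw : 2 < w := by
    rcases hw2 with ⟨t, rfl⟩; omega
  rcases a with _ | a
  · rw [pow_zero, one_mul] at h2
    exact (Nat.not_even_iff_odd.2 hw2) h2
  have hdvd := (Nat.totient_even hw).two_dvd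
  have hlt := Nat.totient_lt w (by omega)
  have hpos := Nat.totient_pos.2 (by omega : 0 < w)
  have h9 := nine_pow_half_totient_modEq hw hw3
  have hk : 0 < w.totient / 2 := by omega
  have hper := h.lt_period (c := 1) (Dvd.intro_left _ rfl) le_rfl
    (by positivity) (nine_pow_modEq_two_pow_mul (a := a) hw2 h9)
  have : 2 ^ a * (2 * (w.totient / 2)) ≤ 2 ^ a * w := Nat.mul_le_mul_left _ (by omega)
  rw [pow_succ] at hmn
  nlinarith

/-- An odd separating modulus that is small compared with `n` is a prime power. -/
lemma Separates.isPrimePow_of_odd {m n : ℕ} (h : Separates m n) (hm1 : 1 < m)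
    (hmn : m + 3 ≤ 2 * n) (h2 : Odd m) : IsPrimePow m := by
  have h3 := h.not_three_dvd (by omega) hmn
  have hp : (m.minFac).Prime := Nat.minFac_prime (by omega)
  obtain ⟨b, v, hv, hmv⟩ :=
    Nat.exists_eq_pow_mul_and_not_dvd (by omega : m ≠ 0) m.minFac hp.ne_one
  rcases eq_or_ne v 1 with rfl | hv1
  · rw [mul_one] at hmv
    rw [isPrimePow_nat_iff]
    refine ⟨m.minFac, b, hp, Nat.pos_of_ne_zero ?_, hmv.symm⟩
    rintro rfl
    simp at hmv
    omega
  exfalso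
  set u := m.minFac ^ b with hu
  have huv : Nat.Coprime u v := Nat.Coprime.pow_left _ ((hp.coprime_iff_not_dvd).2 hv)
  have hu1 : u ≠ 1 := by
    intro h1
    rw [h1, one_mul] at hmv
    exact hv (hmv ▸ m.minFac_dvd)
  have hdu : u ∣ m := ⟨v, hmv⟩
  have hdv : v ∣ m := ⟨u, by rw [mul_comm]; exact hmv⟩
  have key : ∀ x, x ∣ m → x ≠ 1 → 2 < x ∧ Nat.Coprime 3 x := by
    intro x hx hx1
    have hxo : Odd x := h2.of_dvd_nat hx
    refine ⟨by rcases hxo with ⟨t, rfl⟩; omega, ?_⟩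
    exact (Nat.Prime.coprime_iff_not_dvd Nat.prime_three).2 fun h => h3 (h.trans hx)
  obtain ⟨hu2, hu3⟩ := key u hdu hu1
  obtain ⟨hv2, hv3⟩ := key v hdv hv1
  have hku := nine_pow_half_totient_modEq hu2 hu3
  have hkv := nine_pow_half_totient_modEq hv2 hv3
  obtain ⟨s, hs⟩ := (Nat.totient_even hu2).two_dvd
  obtain ⟨t, ht⟩ := (Nat.totient_even hv2).two_dvd
  have hsu := Nat.totient_lt u (by omega)
  have htv := Nat.totient_lt v (by omega)
  have hspos := Nat.totient_pos.2 (by omega : 0 < u)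
  have htpos := Nat.totient_pos.2 (by omega : 0 < v)
  rw [hs, Nat.mul_div_cancel_left _ two_pos] at hku
  rw [ht, Nat.mul_div_cancel_left _ two_pos] at hkv
  have hst : 0 < s * t := Nat.mul_pos (by omega) (by omega)
  have h9 : 9 ^ (s * t) ≡ 1 [MOD m] := by
    rw [hmv]
    refine (Nat.modEq_and_modEq_iff_modEq_mul huv).1 ⟨?_, ?_⟩
    · rw [pow_mul]; simpa using hku.pow t
    · rw [mul_comm, pow_mul]; simpa using hkv.pow s
  have hper := h.lt_period (c := 1) (Dvd.intro_left _ rfl) le_rfl hst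
    (nine_pow_modEq_four_mul h2 h9)
  have : (2 * s) * (2 * t) ≤ u * v := Nat.mul_le_mul (by omega) (by omega)
  nlinarith

/-- Search the indices `j, …, j + k - 1` for one whose residue modulo `m` is recorded in the bits of
`mask`, adding the residues met on the way to `mask`; an index counts if it is at most
`(m + 3) / 2`. -/
def repeatsEarly (m : ℕ) : ℕ → ℕ → ℕ → Bool
  | 0, _, _ => false
  | k + 1, j, mask =>
    (mask.testBit (salajanShift j % m) && Nat.ble (2 * j) (m + 3)) ||
      repeatsEarly m k (j + 1) (mask ||| 2 ^ (salajanShift j % m))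

lemma exists_of_repeatsEarly {m : ℕ} (k : ℕ) : ∀ j mask : ℕ,
    (∀ r, mask.testBit r → ∃ i, 1 ≤ i ∧ i < j ∧ salajanShift i % m = r) →
    1 ≤ j → repeatsEarly m k j mask →
    ∃ i j', 1 ≤ i ∧ i < j' ∧ 2 * j' ≤ m + 3 ∧ salajanShift i ≡ salajanShift j' [MOD m] := by
  induction k with
  | zero => intro j mask _ _ h; simp [repeatsEarly] at h
  | succ k ih =>
    intro j mask hmask hj h
    rw [repeatsEarly, Bool.or_eq_true, Bool.and_eq_true, Nat.ble_eq] at h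
    rcases h with ⟨h1, h2⟩ | h
    · obtain ⟨i, hi, hij, hr⟩ := hmask _ h1
      exact ⟨i, j, hi, hij, h2, hr⟩
    · refine ih (j + 1) _ (fun r hr => ?_) (by omega) h
      rw [Nat.testBit_or, Bool.or_eq_true, Nat.testBit_two_pow, decide_eq_true_eq] at hr
      rcases hr with hr | hr
      · obtain ⟨i, hi, hij, hr⟩ := hmask r hr
        exact ⟨i, hi, by omega, hr⟩
      · exact ⟨j, hj, by omega, hr⟩

lemma repeatsEarly_of_small : ∀ q < 65, ∀ r < 64, 7 ≤ 64 * q + r →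
    Nat.gcd (64 * q + r) 30 = 1 → repeatsEarly (64 * q + r) (64 * q + r) 1 0 = true := by
  decide +kernel

lemma Separates.false_of_small {m n : ℕ} (h : Separates m n) (hmn : m + 3 ≤ 2 * n)
    (h7 : 7 ≤ m) (hm : m < 4160) (hc : Nat.Coprime m 30) : False := by
  have hq := repeatsEarly_of_small (m / 64) (by omega) (m % 64) (by omega)
  rw [Nat.div_add_mod] at hq
  obtain ⟨i, j, hi, hij, hj, hmod⟩ :=
    exists_of_repeatsEarly m 1 0 (by simp) le_rfl (hq h7 hc)
  have hodd : Odd m := Nat.coprime_two_right.1 (hc.coprime_dvd_right (by norm_num))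
  have := h.eq_of_modEq hodd hi (by omega) (by omega) (by omega) hmod
  omega

open Finset in
/-- If no point of `K` lies on any of the lines `b.1 * x - b.2 * y = c` with `b ∈ B`, then
`K` and `B` cannot both be large. -/
lemma card_mul_card_le_of_no_incidence {F : Type*} [Field F] [Fintype F] [DecidableEq F]
    (c : F) (hc : c ≠ 0) (K B : Finset (F × F)) (hB : ∀ b ∈ B, b.2 ≠ 0)
    (hKB : ∀ k ∈ K, ∀ b ∈ B, b.1 * k.1 - b.2 * k.2 ≠ c) :
    #K * #B ≤ Fintype.card F ^ 3 := by
  classical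
  set q := Fintype.card F with hq
  let I : F × F → F × F → ℤ := fun k b => if b.1 * k.1 - b.2 * k.2 = c then 1 else 0
  let f : F × F → ℤ := fun k => ∑ b ∈ B, I k b
  have hline : ∀ b ∈ B, ∑ k, I k b = q := by
    intro b hb
    have h2 := hB b hb
    rw [Fintype.sum_prod_type]
    have : ∀ x : F, ∑ y : F, I (x, y) b = 1 := by
      intro x
      rw [Finset.sum_eq_single ((b.1 * x - c) / b.2)]
      · have : b.1 * x - b.2 * ((b.1 * x - c) / b.2) = c := by field_simp; ring
        simp [I, this]
      · intro y _ hy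
        simp only [I, ite_eq_right_iff, one_ne_zero, imp_false]
        intro h
        apply hy
        field_simp
        linear_combination -h
      · simp
    simp [this, hq]
  have hpair : ∀ b ∈ B, ∀ b' ∈ B, b ≠ b' → ∑ k, I k b * I k b' ≤ 1 := by
    intro b hb b' hb' hne
    have : ∑ k, I k b * I k b' =
        #{k : F × F | b.1 * k.1 - b.2 * k.2 = c ∧ b'.1 * k.1 - b'.2 * k.2 = c} := by
      simp [I, ← ite_and, and_comm]
    rw [this]
    norm_cast
    rw [Finset.card_le_one]
    rintro ⟨x, y⟩ hk ⟨x', y'⟩ hk'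
    simp only [mem_filter, mem_univ, true_and] at hk hk'
    have hdet : b.1 * b'.2 - b'.1 * b.2 ≠ 0 := by
      intro hdet
      have h2 : b.2 = b'.2 := by
        have : c * (b.2 - b'.2) = 0 := by
          linear_combination (-b.2) * hk.2 + b'.2 * hk.1 - x * hdet
        exact sub_eq_zero.1 ((mul_eq_zero.1 this).resolve_left hc)
      have h1 : b.1 = b'.1 := by
        have : b'.2 * (b.1 - b'.1) = 0 := by
          linear_combination hdet + b'.1 * h2
        exact sub_eq_zero.1 ((mul_eq_zero.1 this).resolve_left (hB b' hb'))
      exact hne (Prod.ext h1 h2)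
    have hx : x = x' := by
      have : (b.1 * b'.2 - b'.1 * b.2) * (x - x') = 0 := by
        linear_combination b'.2 * (hk.1 - hk'.1) - b.2 * (hk.2 - hk'.2)
      exact sub_eq_zero.1 ((mul_eq_zero.1 this).resolve_left hdet)
    have hy : y = y' := by
      have : b.2 * (y - y') = 0 := by
        linear_combination hk'.1 - hk.1 + b.1 * hx
      exact sub_eq_zero.1 ((mul_eq_zero.1 this).resolve_left (hB b hb))
    rw [hx, hy]
  have hsum : ∑ k, f k = q * #B := by
    simp only [f]
    rw [Finset.sum_comm, Finset.sum_congr rfl hline]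
    simp [mul_comm]
  have hself : ∀ b ∈ B, ∑ k, I k b * I k b = q := by
    intro b hb
    rw [← hline b hb]
    exact Finset.sum_congr rfl fun k _ => by simp [I]
  have hsq : ∑ k, f k ^ 2 ≤ q * #B + #B ^ 2 := by
    have h1 : ∑ k, f k ^ 2 = ∑ b ∈ B, ∑ b' ∈ B, ∑ k, I k b * I k b' := by
      simp only [f, sq, Finset.sum_mul_sum]
      rw [Finset.sum_comm]
      exact Finset.sum_congr rfl fun b _ => Finset.sum_comm
    rw [h1]
    calc ∑ b ∈ B, ∑ b' ∈ B, ∑ k, I k b * I k b'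
        ≤ ∑ b ∈ B, ∑ b' ∈ B, ((if b = b' then (q : ℤ) else 0) + 1) := by
          refine Finset.sum_le_sum fun b hb => Finset.sum_le_sum fun b' hb' => ?_
          split_ifs with h
          · subst h
            rw [hself b hb]; omega
          · simpa using hpair b hb b' hb' h
      _ = q * #B + #B ^ 2 := by
          simp [Finset.sum_add_distrib, sq, mul_comm]
  have hvar : ∑ k, (q * f k - #B) ^ 2 ≤ (q : ℤ) ^ 3 * #B := by
    have h1 : ∑ k, (q * f k - #B) ^ 2 =
        (q : ℤ) ^ 2 * ∑ k, f k ^ 2 - 2 * q * #B * ∑ k, f k + (q : ℤ) ^ 2 * #B ^ 2 := by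
      have : ∀ k, (q * f k - #B) ^ 2 =
          (q : ℤ) ^ 2 * f k ^ 2 - 2 * q * #B * f k + (#B : ℤ) ^ 2 := fun k => by ring
      simp only [this, Finset.sum_add_distrib, Finset.sum_sub_distrib, ← Finset.mul_sum,
        Finset.sum_const, Finset.card_univ, Fintype.card_prod, ← hq, nsmul_eq_mul]
      push_cast
      ring
    rw [h1, hsum]
    have : (q : ℤ) ^ 2 * ∑ k, f k ^ 2 ≤ (q : ℤ) ^ 2 * (q * #B + #B ^ 2) := by gcongr
    linarith
  have hK : ∑ k ∈ K, (q * f k - #B) ^ 2 = (#K : ℤ) * (#B : ℤ) ^ 2 := by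
    rw [Finset.sum_congr rfl (g := fun _ => (#B : ℤ) ^ 2)]
    · simp
    · intro k hk
      have : f k = 0 := Finset.sum_eq_zero fun b hb => by simp [I, hKB k hk b hb]
      rw [this]; ring
  have hle : (#K : ℤ) * (#B : ℤ) ^ 2 ≤ (q : ℤ) ^ 3 * #B := by
    rw [← hK]
    exact (Finset.sum_le_sum_of_subset_of_nonneg (Finset.subset_univ K)
      fun k _ _ => sq_nonneg _).trans hvar
  rcases Nat.eq_zero_or_pos #B with h0 | h0
  · simp [h0]
  · have hle' : (#K * #B) * #B ≤ q ^ 3 * #B := by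
      have : ((#K * #B * #B : ℕ) : ℤ) ≤ ((q ^ 3 * #B : ℕ) : ℤ) := by
        push_cast; linarith
      exact_mod_cast this
    exact Nat.le_of_mul_le_mul_right hle' h0

/-- Even powers of `3` with distinct exponents in the separated range are distinct. -/
lemma Separates.nine_pow_injective {m n : ℕ} (h : Separates m n) (hm : Odd m)
    {s t : ℕ} (hs : 2 * s + 2 ≤ n) (ht : 2 * t + 2 ≤ n)
    (hst : (9 : ZMod m) ^ s = 9 ^ t) : s = t := by
  have := h.eq_of_modEq hm (i := 2 * s + 2) (j := 2 * t + 2) (by omega) hs (by omega) ht (by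
    rw [← ZMod.natCast_eq_natCast_iff]
    simp only [salajanShift, show (2 * s + 2) % 2 = 0 by omega,
      show (2 * t + 2) % 2 = 0 by omega]
    push_cast
    rw [pow_add, pow_add, pow_mul, pow_mul, show (3 : ZMod m) ^ 2 = 9 by norm_num, hst])
  omega

/-- No large prime separates more than half as many terms as its size. -/
lemma Separates.false_of_large_prime {p n : ℕ} (h : Separates p n) (hp : p.Prime)
    (hpn : p + 3 ≤ 2 * n) (hlarge : 4096 ≤ p) : False := by
  classical
  have := Fact.mk hp
  have hodd : Odd p := hp.odd_of_ne_two (by omega)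
  have h30 : (3 : ZMod p) ≠ 0 := by
    intro h0
    have : ((3 : ℕ) : ZMod p) = 0 := by exact_mod_cast h0
    rw [ZMod.natCast_eq_zero_iff] at this
    have := Nat.le_of_dvd (by norm_num) this
    omega
  have h10 : (10 : ZMod p) ≠ 0 := by
    intro h0
    have : ((10 : ℕ) : ZMod p) = 0 := by exact_mod_cast h0
    rw [ZMod.natCast_eq_zero_iff] at this
    have := Nat.le_of_dvd (by norm_num) this
    omega
  obtain ⟨q, hq⟩ : ∃ q, q = p / 8 := ⟨_, rfl⟩
  have hinj : ∀ s t : ℕ, s ≤ q → t ≤ q → (9 : ZMod p) ^ s = 9 ^ t → s = t :=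
    fun s t hs ht => h.nine_pow_injective hodd (by omega) (by omega)
  let pw : ℕ → ZMod p := fun s => 9 ^ s
  have hpw : Set.InjOn pw (Finset.range (q + 1)) := by
    intro s hs t ht hst
    simp only [Finset.coe_range, Set.mem_Iio] at hs ht
    exact hinj s t (by omega) (by omega) hst
  let P := (Finset.range (q + 1)).image pw
  have hP : P.card = q + 1 := by
    rw [Finset.card_image_of_injOn hpw, Finset.card_range]
  let X := (Finset.range q).image fun s => 9 * pw s
  have hX : X.card = q := by
    rw [Finset.card_image_of_injOn, Finset.card_range]
    intro s hs t ht hst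
    simp only [Finset.coe_range, Set.mem_Iio] at hs ht
    refine hinj (s) (t) (by omega) (by omega) ?_
    have h9 : (9 : ZMod p) ≠ 0 := by
      rw [show (9 : ZMod p) = 3 * 3 by norm_num]; exact mul_ne_zero h30 h30
    exact mul_left_cancel₀ h9 hst
  let Y := (Finset.range (q + 1)).image fun s => 3 * pw s
  have hY : Y.card = q + 1 := by
    rw [Finset.card_image_of_injOn, Finset.card_range]
    intro s hs t ht hst
    exact hpw hs ht (mul_left_cancel₀ h30 hst)
  have hle := card_mul_card_le_of_no_incidence (10 : ZMod p) h10 (P ×ˢ P) (X ×ˢ Y) (by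
      intro b hb
      obtain ⟨-, hb⟩ := Finset.mem_product.1 hb
      obtain ⟨s, -, hs⟩ := Finset.mem_image.1 hb
      rw [← hs]
      simp only [pw]
      rw [show (9 : ZMod p) = 3 * 3 by norm_num]
      exact mul_ne_zero h30 (pow_ne_zero _ (mul_ne_zero h30 h30))) (by
    intro k hk b hb
    obtain ⟨hk1, hk2⟩ := Finset.mem_product.1 hk
    obtain ⟨hb1, hb2⟩ := Finset.mem_product.1 hb
    obtain ⟨s, hs, hs'⟩ := Finset.mem_image.1 hk1
    obtain ⟨t, ht, ht'⟩ := Finset.mem_image.1 hk2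
    obtain ⟨u, hu, hu'⟩ := Finset.mem_image.1 hb1
    obtain ⟨v, hv, hv'⟩ := Finset.mem_image.1 hb2
    rw [Finset.mem_range] at hs ht hu hv
    have := h.three_pow_sub_ne hodd (i := 2 * (1 + u + s)) (j := 2 * (v + t) + 1) (by omega)
      (by omega) (by simp) (by omega) (by simp)
    rw [← hs', ← ht', ← hu', ← hv']
    simp only [pw]
    rw [pow_add _ (2 * (v + t)) 1, pow_mul, pow_mul, show (3 : ZMod p) ^ 2 = 9 by norm_num] at this
    intro heq
    apply this
    rw [← heq]
    ring)
  rw [Finset.card_product, Finset.card_product, hP, hX, hY, ZMod.card] at hle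
  have h512 : 512 ≤ q := by omega
  have h1 : p < 8 * (q + 1) := by omega
  have h2 : p ^ 3 < (8 * (q + 1)) ^ 3 := Nat.pow_lt_pow_left h1 (by norm_num)
  have h3' : 512 * (q + 1) ^ 3 ≤ q * (q + 1) ^ 3 := Nat.mul_le_mul_right _ h512
  nlinarith

lemma IsCyclic.mem_of_pow_eq_one {G : Type*} [Group G] [Fintype G] [DecidableEq G] [IsCyclic G]
    {k : ℕ} (hk : 0 < k) (S : Finset G) (hS : ∀ x ∈ S, x ^ k = 1) (hcard : k ≤ S.card) {x : G}
    (hx : x ^ k = 1) : x ∈ S := by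
  have hsub : S ⊆ Finset.univ.filter fun a : G => a ^ k = 1 := fun a ha => by simp [hS a ha]
  have heq := Finset.eq_of_subset_of_card_le hsub
    ((IsCyclic.card_pow_eq_one_le hk).trans hcard)
  rw [heq]
  simpa using hx

lemma IsCyclic.exists_pow_eq {G : Type*} [Group G] [Finite G] [IsCyclic G] {g x : G}
    (hx : x ^ orderOf g = 1) : ∃ s : ℕ, g ^ s = x := by
  classical
  have := Fintype.ofFinite G
  have hmem := IsCyclic.mem_of_pow_eq_one (orderOf_pos g)
    ((Finset.range (orderOf g)).image fun i => g ^ i) (by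
      intro y hy
      obtain ⟨i, -, rfl⟩ := Finset.mem_image.1 hy
      rw [← pow_mul, mul_comm, pow_mul, pow_orderOf_eq_one, one_pow])
    (by
      rw [Finset.card_image_of_injOn, Finset.card_range]
      intro i hi j hj hij
      simp only [Finset.coe_range, Set.mem_Iio] at hi hj
      exact pow_injOn_Iio_orderOf hi hj hij) hx
  obtain ⟨i, -, hi⟩ := Finset.mem_image.1 hmem
  exact ⟨i, hi⟩

/-- The line `x ≡ 3 * y - 2 * a` modulo `p` meets the box `[0, (p - 1) / 2]²`. -/
lemma exists_small_on_line {p : ℕ} (hp : 7 ≤ p) (hodd : Odd p) (a : ℕ) :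
    ∃ x y : ℕ, 2 * x < p ∧ 2 * y < p ∧ ∃ z : ℤ, (x : ℤ) - 3 * y = -2 * a + p * z := by
  obtain ⟨w, rfl⟩ := hodd
  set p := 2 * w + 1 with hp'
  obtain ⟨c, hc0, hcp, z, hz⟩ :
      ∃ c : ℤ, 0 ≤ c ∧ c < p ∧ ∃ z : ℤ, c = -2 * a + p * z := by
    refine ⟨(-2 * a) % p, Int.emod_nonneg _ (by omega), Int.emod_lt_of_pos _ (by omega),
      -((-2 * a) / p), ?_⟩
    have := Int.emod_add_mul_ediv (-2 * a : ℤ) p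
    linarith
  rcases lt_or_ge (2 * c) p with h | h
  · exact ⟨c.toNat, 0, by omega, by omega, z, by
      rw [Int.toNat_of_nonneg hc0]; push_cast; linarith⟩
  · refine ⟨(c + 3 * ((p - c + 2) / 3) - p).toNat, ((p - c + 2) / 3).toNat, by omega, by omega,
      z - 1, ?_⟩
    rw [Int.toNat_of_nonneg (by omega), Int.toNat_of_nonneg (by omega)]
    linarith

lemma one_add_pow_of_sq_eq_zero {R : Type*} [CommRing R] {ε : R} (h : ε ^ 2 = 0) (x : ℕ) :
    (1 + ε) ^ x = 1 + x * ε := by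
  induction x with
  | zero => simp
  | succ x ih => rw [pow_succ, ih]; push_cast; linear_combination (x : R) * h

/-- If a power of a prime `p ≥ 7` separates more than half as many terms as its size, then the powers
of `9` modulo it are exactly the squares of units, and one of `-5` and `15` is among them. -/
lemma Separates.exists_nine_pow {p b n : ℕ} (h : Separates (p ^ (b + 1)) n) (hp : p.Prime)
    (h7 : 7 ≤ p) (hmn : p ^ (b + 1) + 3 ≤ 2 * n) :
    ∃ s : ℕ, (9 : ZMod (p ^ (b + 1))) ^ s = -5 ∨ (9 : ZMod (p ^ (b + 1))) ^ s = 15 := by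
  classical
  have hodd : Odd p := hp.odd_of_ne_two (by omega)
  set M := p ^ (b + 1) with hM
  have hMpos : 0 < M := Nat.pow_pos hp.pos
  have : NeZero M := ⟨hMpos.ne'⟩
  have hMp : p ≤ M := by rw [hM]; exact Nat.le_self_pow (by omega) p
  have hMlt : Fact (2 < M) := ⟨by omega⟩
  have hModd : Odd M := hodd.pow
  have : IsCyclic (ZMod M)ˣ := ZMod.isCyclic_units_of_prime_pow p hp (by omega) (b + 1)
  have h3 : Nat.Coprime 3 M :=
    Nat.Coprime.pow_right _ ((Nat.coprime_primes Nat.prime_three hp).2 (by omega))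
  have h5 : Nat.Coprime 5 M :=
    Nat.Coprime.pow_right _ ((Nat.coprime_primes Nat.prime_five hp).2 (by omega))
  let t : (ZMod M)ˣ := ZMod.unitOfCoprime 3 h3
  let f : (ZMod M)ˣ := ZMod.unitOfCoprime 5 h5
  have htv : (t : ZMod M) = 3 := by simp [t]
  have hfv : (f : ZMod M) = 5 := by simp [f]
  obtain ⟨k, hk⟩ := (Nat.totient_even (by omega : 2 < M)).two_dvd
  have hkM : 2 * k < M := hk ▸ Nat.totient_lt M (by omega)
  have hcard : ∀ x : (ZMod M)ˣ, x ^ (2 * k) = 1 := fun x => hk ▸ ZMod.pow_totient x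
  have hkpos : 0 < k := by
    have := Nat.totient_pos.2 hMpos
    omega
  have hord : orderOf (t ^ 2) = k := by
    have hdvd : orderOf (t ^ 2) ∣ k := orderOf_dvd_of_pow_eq_one (by rw [← pow_mul]; exact hcard t)
    have hper := h.lt_period (c := 1) (M := M) (Dvd.intro_left _ rfl) le_rfl
      (orderOf_pos (t ^ 2)) (nine_pow_modEq_four_mul hModd (by
        rw [← ZMod.natCast_eq_natCast_iff]
        have := congrArg (Units.val) (pow_orderOf_eq_one (t ^ 2))
        push_cast [htv] at this
        push_cast
        rw [← this]
        norm_num))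
    obtain ⟨d, hd⟩ := hdvd
    have : d < 2 := by
      by_contra! hd2
      have : orderOf (t ^ 2) * 2 ≤ k := hd ▸ Nat.mul_le_mul_left _ hd2
      omega
    interval_cases d
    · omega
    · omega
  have hsq : ∀ x : (ZMod M)ˣ, x ^ k = 1 ∨ x ^ k = -1 := by
    intro x
    have hne : (1 : (ZMod M)ˣ) ≠ -1 := by
      intro heq
      have := congrArg Units.val heq
      simp only [Units.val_one, Units.val_neg] at this
      exact ZMod.neg_one_ne_one this.symm
    have := IsCyclic.mem_of_pow_eq_one (G := (ZMod M)ˣ) two_pos {1, -1} (by simp)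
      (by rw [Finset.card_pair hne]) (x := x ^ k) (by rw [← pow_mul, mul_comm]; exact hcard x)
    simpa using this
  have hfin : t ^ k * (-1) ^ k = -1 := by
    rcases Nat.even_or_odd k with hke | hko
    · rcases hsq t with h1 | h1
      · exfalso
        obtain ⟨d, hd⟩ := hke
        have hdvd : orderOf (t ^ 2) ∣ d := orderOf_dvd_of_pow_eq_one (by
          rw [← pow_mul, show 2 * d = k by omega, h1])
        have := Nat.le_of_dvd (by omega) hdvd
        omega
      · rw [h1, hke.neg_one_pow, mul_one]
    · rcases hsq t with h1 | h1
      · rw [h1, hko.neg_one_pow, one_mul]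
      · exfalso
        refine h.three_pow_sub_ne hModd (i := 2) (j := k) (by omega) (by omega) even_two
          (by omega) hko ?_
        have := congrArg Units.val h1
        push_cast [htv] at this
        rw [this]
        norm_num
  rcases hsq (-f) with h1 | h1
  · obtain ⟨s, hs⟩ := IsCyclic.exists_pow_eq (g := t ^ 2) (x := -f) (by rw [hord, h1])
    refine ⟨s, Or.inl ?_⟩
    have := congrArg Units.val hs
    push_cast [htv, hfv] at this
    rw [← this]
    norm_num
  · obtain ⟨s, hs⟩ := IsCyclic.exists_pow_eq (g := t ^ 2) (x := t * f) (by
      rw [hord, show t * f = t * (-1) * (-f) by simp, mul_pow, mul_pow, h1, hfin]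
      simp)
    refine ⟨s, Or.inr ?_⟩
    have := congrArg Units.val hs
    push_cast [htv, hfv] at this
    rw [show (15 : ZMod M) = 3 * 5 by norm_num, ← this]
    norm_num

/-- No proper power of a prime `p ≥ 7` separates more than half as many terms as its size. -/
lemma Separates.false_of_prime_pow {p b n : ℕ} (h : Separates (p ^ (b + 2)) n) (hp : p.Prime)
    (h7 : 7 ≤ p) (hmn : p ^ (b + 2) + 3 ≤ 2 * n) : False := by
  have hodd : Odd p := hp.odd_of_ne_two (by omega)
  obtain ⟨s, hs⟩ := Separates.exists_nine_pow (b := b + 1) h hp h7 hmn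
  set M := p ^ (b + 2) with hM
  change (9 : ZMod M) ^ s = -5 ∨ (9 : ZMod M) ^ s = 15 at hs
  have hModd : Odd M := hodd.pow
  have h3 : Nat.Coprime 3 p := (Nat.coprime_primes Nat.prime_three hp).2 (by omega)
  obtain ⟨l, hl⟩ : ∃ l, l = p ^ b * (p - 1) := ⟨_, rfl⟩
  have hlpos : 0 < l := hl ▸ Nat.mul_pos (Nat.pow_pos hp.pos) (by omega)
  have hleven : Even l := by
    rw [hl]
    exact (Nat.Odd.sub_odd hodd odd_one).mul_left _
  have hlM : l * (p + 1) + 1 ≤ M := by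
    have h1 : l * (p + 1) + p ^ b = M := by
      rw [hl, hM]
      obtain ⟨w, rfl⟩ : ∃ w, p = w + 1 := ⟨p - 1, by omega⟩
      simp only [Nat.add_sub_cancel]
      ring
    have := Nat.pow_pos (n := b) hp.pos
    omega
  have hltot : (p ^ (b + 1)).totient = l := by
    rw [hl, Nat.totient_prime_pow hp (by omega)]; simp
  obtain ⟨ε, hε, hε2, hpε⟩ : ∃ ε : ZMod M, (3 : ZMod M) ^ l = 1 + ε ∧ ε ^ 2 = 0 ∧ p * ε = 0 := by
    have h1 : 3 ^ l ≡ 1 [MOD p ^ (b + 1)] := hltot ▸ Nat.ModEq.pow_totient (h3.pow_right _)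
    obtain ⟨z, hz⟩ := (Nat.modEq_iff_dvd' (Nat.one_le_pow _ _ (by norm_num))).1 h1.symm
    have h0 : ((p ^ (b + 2) : ℕ) : ZMod M) = 0 := by rw [← hM]; exact ZMod.natCast_self M
    push_cast at h0
    refine ⟨(p : ZMod M) ^ (b + 1) * z, ?_, ?_, ?_⟩
    · have h2 : 3 ^ l = 1 + p ^ (b + 1) * z := by
        have := Nat.one_le_pow l 3 (by norm_num)
        omega
      exact_mod_cast congrArg (Nat.cast (R := ZMod M)) h2
    · linear_combination (p : ZMod M) ^ b * z ^ 2 * h0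
    · linear_combination (z : ZMod M) * h0
  have hpow : ∀ r x : ℕ, (3 : ZMod M) ^ (r + x * l) = 3 ^ r * (1 + x * ε) := by
    intro r x
    rw [pow_add, mul_comm x l, pow_mul, hε, one_add_pow_of_sq_eq_zero hε2]
  obtain ⟨a, r, hr1, hrl, hre, hra⟩ : ∃ a r : ℕ, 1 ≤ r ∧ r ≤ l ∧ Even r ∧
      (3 : ZMod M) ^ r * (1 + a * ε) = 9 ^ s := by
    have hper : (3 : ZMod M) ^ (2 * s + p * l) = 9 ^ s := by
      rw [hpow, hpε, pow_mul]; norm_num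
    have hpl : 0 < p * l := Nat.mul_pos hp.pos hlpos
    have hdm := Nat.mod_add_div (2 * s + p * l - 1) l
    have hml := Nat.mod_lt (2 * s + p * l - 1) hlpos
    refine ⟨(2 * s + p * l - 1) / l, (2 * s + p * l - 1) % l + 1, by omega, by omega, ?_, ?_⟩
    · have h1 : (2 * s + p * l - 1) % l + 1 + l * ((2 * s + p * l - 1) / l) = 2 * s + p * l := by
        omega
      have h2 : Even ((2 * s + p * l - 1) % l + 1 + l * ((2 * s + p * l - 1) / l)) := by
        rw [h1]; exact (even_two_mul s).add (hleven.mul_left p)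
      exact (Nat.even_add.1 h2).2 (hleven.mul_right _)
    · rw [← hpow, ← hper]
      congr 1
      rw [mul_comm (_ / l) l]
      omega
  obtain ⟨x, y, hx, hy, z, hz⟩ := exists_small_on_line h7 hodd a
  have hz' : (x : ZMod M) - 3 * y = -2 * a + p * z := by exact_mod_cast congrArg (Int.cast) hz
  have hbound : ∀ u : ℕ, 2 * u < p → 2 * (r + u * l) + 1 ≤ M := by
    intro u hu
    have : (2 * u + 2) * l ≤ (p + 1) * l := by
      apply Nat.mul_le_mul_right
      rcases hodd with ⟨w, rfl⟩; omega
    nlinarith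
  have hxb := hbound x hx
  have hyb := hbound y hy
  have heven : ∀ u : ℕ, Even (r + u * l) := fun u => hre.add (hleven.mul_left u)
  rcases hs with hs | hs
  · refine h.three_pow_sub_ne hModd (i := r + x * l) (j := r + y * l + 1) (by omega) (by omega)
      (heven x) (by omega) (heven y).add_one ?_
    rw [pow_succ, hpow, hpow]
    linear_combination (3 : ZMod M) ^ r * ε * hz' + (3 : ZMod M) ^ r * z * hpε - 2 * (hra.trans hs)
  · obtain ⟨r', rfl⟩ : ∃ r', r = r' + 1 := ⟨r - 1, by omega⟩
    have hodd' : Odd (r' + x * l) := by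
      have := heven x
      rw [show r' + 1 + x * l = r' + x * l + 1 by ring, Nat.even_add_one] at this
      exact Nat.not_even_iff_odd.1 this
    refine h.three_pow_sub_ne hModd (i := r' + 1 + y * l) (j := r' + x * l) (by omega)
      (by omega) (heven y) (by omega) hodd' ?_
    rw [hpow, hpow]
    have hu : IsUnit (3 : ZMod M) := by
      have : IsUnit ((3 : ℕ) : ZMod M) :=
        (ZMod.isUnit_iff_coprime 3 M).2 (h3.pow_right _)
      exact_mod_cast this
    have h2 := hra.trans hs
    rw [pow_succ] at h2 ⊢
    apply hu.mul_left_cancel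
    linear_combination (-(3 : ZMod M) ^ r' * 3 * ε) * hz' - (3 : ZMod M) ^ r' * 3 * z * hpε + 2 * h2

lemma separates_of_lt {m n : ℕ} (h : ∀ i d, 1 ≤ i → 0 < d → i + d ≤ n →
    ¬ salajanShift i ≡ salajanShift (i + d) [MOD 4 * m]) : Separates m n := by
  intro i hi hin j hj hjn hij
  rcases lt_trichotomy i j with hlt | heq | hlt
  · exact absurd hij (by simpa [Nat.add_sub_of_le hlt.le] using h i (j - i) hi (by omega) (by omega))
  · exact heq
  · exact absurd hij.symm
      (by simpa [Nat.add_sub_of_le hlt.le] using h j (i - j) hj (by omega) (by omega))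

lemma dvd_three_pow_sub_one_of_modEq {M i d : ℕ} (hd : Even d) (hM : Nat.Coprime 3 M)
    (h : salajanShift i ≡ salajanShift (i + d) [MOD M]) : M ∣ 3 ^ d - 1 := by
  rw [salajanShift, salajanShift, show (i + d) % 2 = i % 2 by
    rw [Nat.add_mod, Nat.even_iff.1 hd]; simp] at h
  have h1 := h.add_right_cancel'
  have h2 : 3 ^ i * 1 ≡ 3 ^ i * 3 ^ d [MOD M] := by rw [mul_one, ← pow_add]; exact h1
  have h3 : 1 ≡ 3 ^ d [MOD M] :=
    Nat.ModEq.cancel_left_of_coprime ((hM.pow_left i).symm) h2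
  exact (Nat.modEq_iff_dvd' (Nat.one_le_pow _ _ (by norm_num))).1 h3

lemma three_pow_modEq_pow_mod_four (M i : ℕ) (hM : 3 ^ 4 ≡ 1 [MOD M]) :
    3 ^ i ≡ 3 ^ (i % 4) [MOD M] := by
  conv_lhs => rw [← Nat.mod_add_div i 4, pow_add, pow_mul]
  simpa using (hM.pow (i / 4)).mul_left (3 ^ (i % 4))

lemma separates_two_pow {e n : ℕ} (hn : n ≤ 2 ^ e) : Separates (2 ^ e) n := by
  refine separates_of_lt fun i d hi hd hid h => ?_
  have he : e ≠ 0 := by rintro rfl; simp at hn; omega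
  have h8 : salajanShift i ≡ salajanShift (i + d) [MOD 8] := h.of_dvd (by
    obtain ⟨e, rfl⟩ := Nat.exists_eq_succ_of_ne_zero he
    exact ⟨2 ^ e, by rw [pow_succ]; ring⟩)
  have hmod : ∀ j, salajanShift j ≡ 1 + 4 * (j % 2) [MOD 8] := by
    intro j
    have h1 := (three_pow_modEq_pow_mod_four 8 j (by decide)).add_right (10 * (j % 2))
    refine h1.trans ?_
    have : j % 4 < 4 := Nat.mod_lt _ (by norm_num)
    rw [show j % 2 = j % 4 % 2 by omega]
    interval_cases j % 4 <;> decide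
  have heven : Even d := by
    have h2 := ((hmod i).symm.trans h8).trans (hmod (i + d))
    rw [Nat.even_iff]
    simp only [Nat.ModEq] at h2
    omega
  have hdvd := dvd_three_pow_sub_one_of_modEq heven (by
    rw [show 4 * 2 ^ e = 2 ^ (e + 2) by ring]
    exact Nat.Coprime.pow_right _ (by norm_num)) h
  rw [show 4 * 2 ^ e = 2 ^ (e + 2) by ring] at hdvd
  have hne : 3 ^ d - 1 ≠ 0 := by
    have := Nat.one_lt_pow hd.ne' (by norm_num : 1 < 3)
    omega
  have hv := padicValNat.pow_two_sub_one (x := 3) (n := d) (by norm_num) (by norm_num) hd.ne' heven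
  have h4 : padicValNat 2 (3 + 1) = 2 := by
    rw [show 3 + 1 = 2 ^ 2 by norm_num, padicValNat.prime_pow]
  have h2 : padicValNat 2 (3 - 1) = 1 := by
    rw [show 3 - 1 = 2 by norm_num, padicValNat_self]
  have hle := (padicValNat_dvd_iff_le hne).1 hdvd
  have : 2 ^ e ∣ d := (padicValNat_dvd_iff_le hd.ne').2 (by omega)
  have := Nat.le_of_dvd hd this
  omega

lemma separates_five_pow {f n : ℕ} (hn : 5 * n ≤ 4 * 5 ^ f) : Separates (5 ^ f) n := by
  refine separates_of_lt fun i d hi hd hid h => ?_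
  have hf : f ≠ 0 := by rintro rfl; simp at hn; omega
  obtain ⟨f, rfl⟩ := Nat.exists_eq_succ_of_ne_zero hf
  have h5 : salajanShift i ≡ salajanShift (i + d) [MOD 5] := h.of_dvd
    ⟨4 * 5 ^ f, by rw [Nat.succ_eq_add_one, pow_succ]; ring⟩
  have hmod : ∀ j, salajanShift j ≡ 3 ^ (j % 4) [MOD 5] := by
    intro j
    have h1 : 10 * (j % 2) ≡ 0 [MOD 5] := (Nat.modEq_zero_iff_dvd).2 ⟨2 * (j % 2), by ring⟩
    simpa [salajanShift] using (three_pow_modEq_pow_mod_four 5 j (by decide)).add h1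
  obtain ⟨t, rfl⟩ : 4 ∣ d := by
    have h2 := ((hmod i).symm.trans h5).trans (hmod (i + d))
    have hi4 : i % 4 < 4 := Nat.mod_lt _ (by norm_num)
    have hd4 : (i + d) % 4 < 4 := Nat.mod_lt _ (by norm_num)
    have : i % 4 = (i + d) % 4 := by
      revert h2
      interval_cases i % 4 <;> interval_cases (i + d) % 4 <;> decide
    omega
  have hdvd := dvd_three_pow_sub_one_of_modEq (M := 5 ^ (f + 1))
    ⟨2 * t, by ring⟩ (Nat.Coprime.pow_right _ (by norm_num)) (h.of_dvd (dvd_mul_left _ _))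
  have ht : t ≠ 0 := by omega
  rw [pow_mul, show 3 ^ 4 = 81 by norm_num] at hdvd
  have hne : 81 ^ t - 1 ≠ 0 := by
    have := Nat.one_lt_pow ht (by norm_num : 1 < 81)
    omega
  have : Fact (Nat.Prime 5) := ⟨Nat.prime_five⟩
  have hv := padicValNat.pow_sub_pow (p := 5) (by decide) (x := 81) (y := 1) (by norm_num)
    (by norm_num) (by norm_num) ht
  rw [one_pow] at hv
  have h80 : padicValNat 5 (81 - 1) = 1 := by
    rw [show 81 - 1 = 5 * 16 by norm_num, padicValNat.mul (by norm_num) (by norm_num),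
      padicValNat_self, padicValNat.eq_zero_of_not_dvd (by norm_num)]
  have hle := (padicValNat_dvd_iff_le hne).1 hdvd
  have : 5 ^ f ∣ t := (padicValNat_dvd_iff_le ht).2 (by omega)
  have := Nat.le_of_dvd (by omega) this
  rw [Nat.succ_eq_add_one, pow_succ] at hn
  omega

/-- A separating modulus that is small compared with `n` is a power of `2` or of `5`. -/
lemma Separates.eq_pow {m n : ℕ} (h : Separates m n) (hm : 0 < m) (hmn : m + 3 ≤ 2 * n) :
    (∃ a, m = 2 ^ a) ∨ ∃ b, m = 5 ^ (b + 1) := by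
  rcases Nat.even_or_odd m with h2 | h2
  · exact Or.inl (h.eq_two_pow_of_even hm hmn h2)
  rcases eq_or_ne m 1 with rfl | hm1
  · exact Or.inl ⟨0, rfl⟩
  have hpp := h.isPrimePow_of_odd (by omega) hmn h2
  have h3 := h.not_three_dvd hm hmn
  obtain ⟨p, b, hp, hb, rfl⟩ := (isPrimePow_nat_iff m).1 hpp
  obtain ⟨b, rfl⟩ : ∃ c, b = c + 1 := ⟨b - 1, by omega⟩
  have hpdvd : p ∣ p ^ (b + 1) := dvd_pow_self p (by omega)
  rcases eq_or_ne p 5 with rfl | hp5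
  · exact Or.inr ⟨b, rfl⟩
  exfalso
  have hpodd : Odd p := h2.of_dvd_nat hpdvd
  have hp3 : p ≠ 3 := by rintro rfl; exact h3 hpdvd
  have hp7 : 7 ≤ p := by
    have := hp.two_le
    rcases hpodd with ⟨w, rfl⟩
    omega
  rcases b with _ | b
  · rw [zero_add, pow_one] at h hmn
    rcases lt_or_ge p 4160 with hlt | hge
    · refine h.false_of_small hmn hp7 hlt ?_
      rw [show 30 = 2 * 3 * 5 by norm_num]
      refine Nat.Coprime.mul_right (Nat.Coprime.mul_right ?_ ?_) ?_
      · exact (Nat.coprime_primes hp Nat.prime_two).2 (by omega)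
      · exact (Nat.coprime_primes hp Nat.prime_three).2 hp3
      · exact (Nat.coprime_primes hp Nat.prime_five).2 hp5
    · exact h.false_of_large_prime hp hmn (by omega)
  · exact h.false_of_prime_pow hp hp7 hmn

lemma Separates.min_le {m n e f : ℕ} (h : Separates m n) (hm : 0 < m) (hn : 1 ≤ n)
    (he' : ∀ e' : ℕ, e' < e → 2 ^ e' < n) (hf' : ∀ f' : ℕ, f' < f → 4 * 5 ^ f' < 5 * n) :
    min (2 ^ e) (5 ^ f) ≤ m := by
  by_contra! hlt
  obtain ⟨hlt2, hlt5⟩ := lt_min_iff.1 hlt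
  obtain ⟨e, rfl⟩ : ∃ c, e = c + 1 := by
    refine ⟨e - 1, ?_⟩
    have : e ≠ 0 := by rintro rfl; simp at hlt2; omega
    omega
  have hen := he' e (by omega)
  have hmn : m + 3 ≤ 2 * n := by rw [pow_succ] at hlt2; omega
  rcases h.eq_pow hm hmn with ⟨a, rfl⟩ | ⟨b, rfl⟩
  · have hae : a < e + 1 := (Nat.pow_lt_pow_iff_right (by norm_num)).1 hlt2
    have han := he' a hae
    rcases a with _ | a
    · have := h 1 le_rfl hn 2 (by omega) (Nat.succ_le_of_lt (by simpa using han)) (by decide)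
      omega
    · have := h.lt_period (c := 1) (M := 2 ^ (a + 1) * 1) (by simp) le_rfl
        (by positivity) (nine_pow_modEq_two_pow_mul (a := a) (k := 1) odd_one Nat.modEq_one)
      rw [pow_succ] at han
      omega
  · have hbf : b + 1 < f := (Nat.pow_lt_pow_iff_right (by norm_num)).1 hlt5
    have hbn := hf' (b + 1) hbf
    have h9 := nine_pow_half_totient_modEq (w := 5 ^ (b + 1))
      (by rw [pow_succ]; have := Nat.pow_pos (n := b) (by norm_num : 0 < 5); omega)
      (Nat.Coprime.pow_right _ (by norm_num))
    rw [Nat.totient_prime_pow Nat.prime_five (by omega), Nat.add_sub_cancel,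
      show 5 ^ b * (5 - 1) / 2 = 5 ^ b * 2 by omega] at h9
    have := h.lt_period (c := 1) (M := 5 ^ (b + 1)) (Dvd.intro_left _ rfl) le_rfl
      (by positivity) (nine_pow_modEq_four_mul (Odd.pow (by decide)) h9)
    rw [pow_succ] at hbn
    omega

/-- For every `n ≥ 1`, if `e` is the smallest nonnegative integer with
`2^e ≥ n` and `f` is the smallest nonnegative integer with `4·5^f ≥ 5·n`, then
`D_5(n) = min (2^e) (5^f)`. -/
theorem stmt3 (n : ℕ) (hn : 1 ≤ n) (e f : ℕ)
    (he : 2 ^ e ≥ n) (he' : ∀ e' : ℕ, e' < e → 2 ^ e' < n)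
    (hf : 4 * 5 ^ f ≥ 5 * n) (hf' : ∀ f' : ℕ, f' < f → 4 * 5 ^ f' < 5 * n) :
    salajanDisc n = min (2 ^ e) (5 ^ f) := by
  have hset : {m : ℕ | 0 < m ∧ ∀ i, 1 ≤ i → i ≤ n → ∀ j, 1 ≤ j → j ≤ n →
      salajan i ≡ salajan j [ZMOD (m : ℤ)] → i = j} = {m : ℕ | 0 < m ∧ Separates m n} := by
    simp only [salajan_modEq_iff, Separates]
  rw [salajanDisc, hset]
  apply IsLeast.csInf_eq
  refine ⟨⟨by positivity, ?_⟩, fun m hm => hm.2.min_le hm.1 hn he' hf'⟩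
  rcases min_choice (2 ^ e) (5 ^ f) with hmin | hmin
  · rw [hmin]
    exact separates_two_pow he
  · rw [hmin]
    exact separates_five_pow hf
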